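/- Under the setting of the previous statement (positive-definite Σ with acyclic dependency graph G = (V,E)), the determinant satisfies 1/|Σ| = (∏_{i ∈ V} Σ(i,i)^{Deg(i)−1}) / (∏_{(i,j) ∈ E, i<j} [Σ(i,i)Σ(j,j) − Σ(i,j)²]). -/

import Mathlib

namespace SimpleGraph

variable {V : Type*} {G : SimpleGraph V}

/-- A finite nonempty forest has a vertex with at most one neighbour. -/
theorem IsAcyclic.exists_forall_adj_eq [Fintype V] [Nonempty V] (hac : G.IsAcyclic) :
    ∃ l p : V, ∀ w, G.Adj l w → w = p := by
  by_contra! h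
  have hpath : ∀ m : ℕ, ∃ (u v : V) (q : G.Walk u v), q.IsPath ∧ q.length = m := by
    intro m
    induction m with
    | zero => exact ⟨Classical.arbitrary V, _, .nil, .nil, rfl⟩
    | succ m ih =>
      obtain ⟨u, v, q, hq, hlen⟩ := ih
      obtain ⟨w, hvw, hw⟩ := h v q.penultimate
      have hnot : w ∉ q.support := fun hmem ↦ hw (hac.eq_penultimate_of_adj_end hq hvw hmem)
      exact ⟨u, w, q.concat hvw, hq.concat hnot hvw, by simp [hlen]⟩
  obtain ⟨u, v, q, hq, hlen⟩ := hpath (Fintype.card V)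
  exact hq.length_lt.ne hlen

/-- The degree of a vertex splits off its adjacency to a distinguished vertex. -/
theorem degree_succAbove {n : ℕ} (G : SimpleGraph (Fin (n + 1))) [DecidableRel G.Adj]
    (l : Fin (n + 1)) (i : Fin n) :
    G.degree (l.succAbove i) =
      (G.comap l.succAbove).degree i + if G.Adj l (l.succAbove i) then 1 else 0 := by
  simp only [← card_neighborFinset_eq_degree, neighborFinset_eq_filter, Finset.card_filter,
    Fin.sum_univ_succAbove _ l, comap_adj, G.adj_comm _ l]
  rw [add_comm]

/-- The edges of a graph on `Fin (n + 1)` are those at `l` together with those avoiding `l`. -/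
theorem prod_edges_succAbove {n : ℕ} {M : Type*} [CommMonoid M]
    (G : SimpleGraph (Fin (n + 1))) [DecidableRel G.Adj] (l : Fin (n + 1))
    (f : Fin (n + 1) → Fin (n + 1) → M) (hf : ∀ i j, f i j = f j i) :
    ∏ p : Fin (n + 1) × Fin (n + 1) with p.1 < p.2 ∧ G.Adj p.1 p.2, f p.1 p.2 =
      (∏ i, if G.Adj l (l.succAbove i) then f l (l.succAbove i) else 1) *
        ∏ p : Fin n × Fin n with p.1 < p.2 ∧ (G.comap l.succAbove).Adj p.1 p.2,
          f (l.succAbove p.1) (l.succAbove p.2) := by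
  simp only [Finset.prod_filter, Fintype.prod_prod_type, Fin.prod_univ_succAbove _ l,
    Finset.prod_mul_distrib, lt_irrefl, false_and, if_false, one_mul, comap_adj,
    Fin.succAbove_lt_succAbove_iff]
  rw [← mul_assoc, ← Finset.prod_mul_distrib]
  congr 1
  refine Finset.prod_congr rfl fun i _ ↦ ?_
  rcases lt_or_gt_of_ne (Fin.succAbove_ne l i) with h | h <;>
    simp [h, h.not_gt, G.adj_comm _ l, hf _ l]

end SimpleGraph

namespace Matrix

variable {n : ℕ} {K : Type*} [Field K]

theorem det_mul_inv_apply_self (S : Matrix (Fin (n + 1)) (Fin (n + 1)) K) (hS : S.det ≠ 0)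
    (l : Fin (n + 1)) :
    S.det * S⁻¹ l l = (S.submatrix l.succAbove l.succAbove).det := by
  rw [inv_def, smul_apply, adjugate_fin_succ_eq_det_submatrix, smul_eq_mul,
    Ring.inverse_eq_inv', mul_inv_cancel_left₀ hS, Even.neg_one_pow ⟨_, rfl⟩, one_mul]

/-- The inverse of a principal submatrix is a Schur complement in the inverse. -/
theorem inv_submatrix_succAbove (S : Matrix (Fin (n + 1)) (Fin (n + 1)) K) (hS : S.det ≠ 0)
    (l : Fin (n + 1)) (hl : S⁻¹ l l ≠ 0) :
    (S.submatrix l.succAbove l.succAbove)⁻¹ = of fun i j ↦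
      S⁻¹ (l.succAbove i) (l.succAbove j) -
        S⁻¹ (l.succAbove i) l * S⁻¹ l (l.succAbove j) / S⁻¹ l l := by
  apply inv_eq_right_inv
  have hmul (i j) : ∑ k, S i k * S⁻¹ k j = (1 : Matrix _ _ K) i j := by
    rw [← mul_nonsing_inv S hS.isUnit, mul_apply]
  ext i j
  have h₁ := hmul (l.succAbove i) (l.succAbove j)
  have h₂ := hmul (l.succAbove i) l
  rw [Fin.sum_univ_succAbove _ l, one_apply] at h₁ h₂
  simp only [Fin.succAbove_right_inj, Fin.succAbove_ne, if_false] at h₁ h₂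
  simp only [mul_apply, submatrix_apply, of_apply, mul_sub, Finset.sum_sub_distrib, one_apply,
    ← mul_assoc, mul_div_assoc, ← Finset.sum_mul]
  rw [← h₁, eq_neg_of_add_eq_zero_right h₂]
  field_simp
  ring

/-- If the inverse of a positive definite matrix is supported on the edges of a forest, its
determinant factors over the vertices and edges of the forest. -/
theorem PosDef.prod_degree_mul_det_eq_prod_edges {S : Matrix (Fin n) (Fin n) ℝ} (hpd : S.PosDef)
    (G : SimpleGraph (Fin n)) [DecidableRel G.Adj] (hac : G.IsAcyclic)
    (hzero : ∀ i j : Fin n, i ≠ j → ¬ G.Adj i j → S⁻¹ i j = 0) :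
    (∏ i, S i i ^ ((G.degree i : ℤ) - 1)) * S.det =
      ∏ p : Fin n × Fin n with p.1 < p.2 ∧ G.Adj p.1 p.2,
        (S p.1 p.1 * S p.2 p.2 - S p.1 p.2 ^ 2) := by
  induction n with
  | zero => simp
  | succ n ih =>
    obtain ⟨l, p, hlp⟩ := hac.exists_forall_adj_eq
    have hdet : S.det ≠ 0 := hpd.det_pos.ne'
    have hl : S⁻¹ l l ≠ 0 := hpd.inv.diag_pos.ne'
    have hS (i : Fin (n + 1)) : S i i ≠ 0 := hpd.diag_pos.ne'
    have hsymm (i j : Fin (n + 1)) : S i j = S j i := by simpa using hpd.isHermitian.apply j i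
    have hIsymm (i j : Fin (n + 1)) : S⁻¹ i j = S⁻¹ j i := by
      simpa using hpd.inv.isHermitian.apply j i
    have hrow (j) : ∑ k, S⁻¹ l k * S k j = (1 : Matrix _ _ ℝ) l j := by
      rw [← nonsing_inv_mul S hdet.isUnit, mul_apply]
    have ih := ih (hpd.submatrix (Fin.succAbove_right_injective (p := l)))
      (G.comap l.succAbove) (hac.of_comap ⟨_, Fin.succAbove_right_injective⟩) (by
        intro i j hij hadj
        rw [inv_submatrix_succAbove S hdet l hl, of_apply,
          hzero _ _ (Fin.succAbove_right_injective.ne hij) hadj]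
        suffices S⁻¹ (l.succAbove i) l * S⁻¹ l (l.succAbove j) = 0 by simp [this]
        by_contra! h
        obtain ⟨hi, hj⟩ := mul_ne_zero_iff.mp h
        rw [hIsymm] at hi
        have hnbr (k) (hk : S⁻¹ l (l.succAbove k) ≠ 0) : l.succAbove k = p :=
          hlp _ (not_not.mp fun hn ↦ hk (hzero _ _ (Fin.succAbove_ne l k).symm hn))
        exact hij (Fin.succAbove_right_injective ((hnbr i hi).trans (hnbr j hj).symm)))
    rw [← det_mul_inv_apply_self S hdet] at ih
    simp only [submatrix_apply] at ih
    rw [G.prod_edges_succAbove l (fun i j ↦ S i i * S j j - S i j ^ 2)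
      (fun i j ↦ by rw [hsymm i j]; ring), ← ih, Fin.prod_univ_succAbove _ l]
    have hpow (i : Fin n) : S (l.succAbove i) (l.succAbove i) ^
          ((G.degree (l.succAbove i) : ℤ) - 1) =
        S (l.succAbove i) (l.succAbove i) ^ (((G.comap l.succAbove).degree i : ℤ) - 1) *
          if G.Adj l (l.succAbove i) then S (l.succAbove i) (l.succAbove i) else 1 := by
      rw [G.degree_succAbove]
      split_ifs
      · rw [← zpow_add_one₀ (hS _)]
        congr 1
        push_cast
        ring
      · simp
    simp only [hpow, Finset.prod_mul_distrib]
    by_cases hadj : G.Adj l p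
    · obtain ⟨q, rfl⟩ := Fin.exists_succAbove_eq hadj.ne'
      have hiff (i) : G.Adj l (l.succAbove i) ↔ i = q :=
        ⟨fun h ↦ Fin.succAbove_right_injective (hlp _ h), fun h ↦ h ▸ hadj⟩
      have hdeg : G.degree l = 1 := by
        rw [SimpleGraph.degree_eq_one_iff_existsUnique_adj]
        exact ⟨_, hadj, hlp⟩
      have hvanish (i) (hi : i ≠ q) : S⁻¹ l (l.succAbove i) = 0 :=
        hzero _ _ (Fin.succAbove_ne l i).symm (mt (hiff i).mp hi)
      have hrow' (j) : S⁻¹ l l * S l j + S⁻¹ l (l.succAbove q) * S (l.succAbove q) j =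
          (1 : Matrix _ _ ℝ) l j := by
        rw [← hrow, Fin.sum_univ_succAbove _ l, Fintype.sum_eq_single q]
        intro i hi
        rw [hvanish i hi, zero_mul]
      have h₁ := hrow' l
      have h₂ := hrow' (l.succAbove q)
      rw [one_apply_eq, hsymm (l.succAbove q) l] at h₁
      rw [one_apply_ne (Fin.succAbove_ne l q).symm] at h₂
      have hschur : S⁻¹ l l * (S l l * S (l.succAbove q) (l.succAbove q) -
          S l (l.succAbove q) ^ 2) = S (l.succAbove q) (l.succAbove q) := by
        linear_combination S (l.succAbove q) (l.succAbove q) * h₁ - S l (l.succAbove q) * h₂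
      simp only [hiff, Finset.prod_ite_eq', Finset.mem_univ, if_true, hdeg, Nat.cast_one, sub_self,
        zpow_zero, one_mul]
      set P := ∏ i : Fin n, S (l.succAbove i) (l.succAbove i) ^
        (((G.comap l.succAbove).degree i : ℤ) - 1)
      linear_combination -(P * S.det) * hschur
    · have hnone (i) : ¬ G.Adj l (l.succAbove i) := fun h ↦ hadj (hlp _ h ▸ h)
      have hdeg : G.degree l = 0 := by
        rw [SimpleGraph.degree_eq_zero]
        exact fun w hw ↦ hadj (hlp _ hw ▸ hw)
      have hone : S⁻¹ l l * S l l = 1 := by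
        rw [← one_apply_eq (α := ℝ) l, ← hrow, Fin.sum_univ_succAbove _ l,
          Finset.sum_eq_zero, add_zero]
        intro i _
        rw [hzero _ _ (Fin.succAbove_ne l i).symm (hnone i), zero_mul]
      have hpow_l : S l l ^ ((G.degree l : ℤ) - 1) = S⁻¹ l l := by
        rw [hdeg, eq_inv_of_mul_eq_one_left hone]
        simp
      simp only [hnone, if_false, Finset.prod_const_one, hpow_l, one_mul, mul_one]
      ring

end Matrix


theorem stmt_2 {n : ℕ} (S : Matrix (Fin n) (Fin n) ℝ)
    (hsymm : S.IsSymm) (hpd : S.PosDef)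
    (G : SimpleGraph (Fin n)) [DecidableRel G.Adj] (hac : G.IsAcyclic)
    (hzero : ∀ i j : Fin n, i ≠ j → ¬ G.Adj i j → S⁻¹ i j = 0)
    (hmarkov : ∀ i j k : Fin n, G.Adj i j → G.Adj i k → j ≠ k →
      S j k = S i j * S i k / S i i) :
    1 / S.det =
      (∏ i : Fin n, S i i ^ ((G.degree i : ℤ) - 1)) /
      (∏ p ∈ Finset.univ.filter (fun p : Fin n × Fin n => p.1 < p.2 ∧ G.Adj p.1 p.2),
        (S p.1 p.1 * S p.2 p.2 - S p.1 p.2 ^ 2)) := by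
  have hdet : S.det ≠ 0 := hpd.det_pos.ne'
  have hvert : ∏ i : Fin n, S i i ^ ((G.degree i : ℤ) - 1) ≠ 0 :=
    Finset.prod_ne_zero_iff.mpr fun i _ ↦ zpow_ne_zero _ hpd.diag_pos.ne'
  rw [← hpd.prod_degree_mul_det_eq_prod_edges G hac hzero]
  field_simp
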